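/- arXiv:2406.16421 — 4 statements merged into one kernel-verified Lean document; each statement's English description precedes it below -/
import Mathlib

section
/- Let (A, m) be a Noetherian complete local ring of dimension d, let x ∈ m be an element that is not contained in any minimal prime of A, and let s > 0 be an integer. If the ideal (x) is radical and A/(x) is connected in codimension s, then A is connected in codimension s. -/
noncomputable section

/-- A Noetherian ring `A` (of finite Krull dimension `d`) is *connected in codimension
`s`* if `Spec(A) ∖ Z` is connected for every closed subset `Z ⊆ Spec(A)` with
`dim Z < d - s` (equivalently, `dim Z + s < d`); the empty set counts as disconnected. -/
def ConnectedInCodim (A : Type*) [CommRing A] (s : ℕ) : Prop :=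
  ∀ Z : Set (PrimeSpectrum A), IsClosed Z →
    topologicalKrullDim ↥Z + ((s : ℕ∞) : WithBot ℕ∞) < ringKrullDim A →
    IsConnected Zᶜ

/-- A prime ideal containing the intersection of a set of minimal primes of a Noetherian ring
contains one of them. -/
lemma exists_le_of_sInf_le_of_subset_minimalPrimes {A : Type*} [CommRing A] [IsNoetherianRing A]
    {S : Set (Ideal A)} (hS : S ⊆ minimalPrimes A) {q : Ideal A} (hq : q.IsPrime)
    (h : sInf S ≤ q) : ∃ p ∈ S, p ≤ q := by
  have hfin : S.Finite := ((⊥ : Ideal A).finite_minimalPrimes_of_isNoetherianRing).subset hS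
  rw [← hfin.coe_toFinset, ← Finset.inf_id_eq_sInf, hq.inf_le'] at h
  simpa using h

lemma mem_sInf_of_mul_mem_of_notMem_minimalPrimes {A : Type*} [CommRing A] {S : Set (Ideal A)}
    (hS : S ⊆ minimalPrimes A) {x : A} (hmin : ∀ p ∈ minimalPrimes A, x ∉ p) {a : A}
    (h : x * a ∈ sInf S) : a ∈ sInf S := by
  rw [Ideal.mem_sInf] at h ⊢
  intro p hp
  exact ((hS hp).isPrime.mem_or_mem (h hp)).resolve_left (hmin p (hS hp))

/-- If `x` lies in the Jacobson radical and in no minimal prime, and `(x)` is radical,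
then the ring is reduced. -/
lemma isReduced_of_radical_span_singleton {A : Type*} [CommRing A] [IsNoetherianRing A] {x : A}
    (hx : x ∈ Ideal.jacobson (⊥ : Ideal A)) (hmin : ∀ p ∈ minimalPrimes A, x ∉ p)
    (hrad : (Ideal.span {x}).radical = Ideal.span {x}) : IsReduced A := by
  rw [← nilradical_eq_bot_iff]
  refine Submodule.eq_bot_of_le_smul_of_le_jacobson_bot (Ideal.span {x}) _
    (IsNoetherian.noetherian _) (fun n hn ↦ ?_) ((Ideal.span_singleton_le_iff_mem _).mpr hx)
  have hnx : n ∈ Ideal.span {x} := hrad ▸ Ideal.radical_mono bot_le hn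
  obtain ⟨a, rfl⟩ := Ideal.mem_span_singleton'.mp hnx
  rw [mul_comm a x]
  refine Submodule.smul_mem_smul (Ideal.mem_span_singleton_self x) ?_
  have h : sInf (minimalPrimes A) = nilradical A := Ideal.sInf_minimalPrimes
  rw [← h] at hn ⊢
  exact mem_sInf_of_mul_mem_of_notMem_minimalPrimes subset_rfl hmin (by rwa [mul_comm])

/-- If `(x)` is radical and `x` is a nonzerodivisor modulo `0`, `I` and `J`, where `I * J = 0`,
then `x` lies in no minimal prime of `I + J`. -/
lemma notMem_of_mem_minimalPrimes_sup {A : Type*} [CommRing A] {x : A}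
    (hx : ∀ a, x * a = 0 → a = 0)
    (hrad : (Ideal.span {x}).radical = Ideal.span {x}) {I J : Ideal A}
    (hI : ∀ a, x * a ∈ I → a ∈ I) (hJ : ∀ a, x * a ∈ J → a ∈ J)
    (hIJ : ∀ i ∈ I, ∀ j ∈ J, i * j = 0) {P : Ideal A} (hP : P ∈ (I ⊔ J).minimalPrimes) :
    x ∉ P := by
  intro hxP
  have hPp : P.IsPrime := hP.isPrime
  have key : ∀ (n : ℕ) (t : A), t * x ^ n ∈ I ⊔ J → t ∈ I ⊔ J := by
    intro n
    induction n with
    | zero => intro t ht; simpa using ht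
    | succ n ih =>
      intro t ht
      refine ih t ?_
      obtain ⟨i, hi, j, hj, hij⟩ := Submodule.mem_sup.mp ht
      have hmem : ∀ k l : A, k + l = t * x ^ (n + 1) → k * l = 0 → k ∈ Ideal.span {x} := by
        intro k l hkl h0
        rw [← hrad]
        refine ⟨2, Ideal.mem_span_singleton'.mpr ⟨k * t * x ^ n, ?_⟩⟩
        linear_combination (-k) * hkl + h0
      obtain ⟨a, rfl⟩ := Ideal.mem_span_singleton.mp (hmem i j hij (hIJ i hi j hj))
      obtain ⟨b, rfl⟩ := Ideal.mem_span_singleton.mp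
        (hmem j _ (by rw [add_comm, hij]) (by rw [mul_comm, hIJ _ hi j hj]))
      have hab : a + b = t * x ^ n :=
        sub_eq_zero.mp (hx _ (by linear_combination hij))
      rw [← hab]
      exact Submodule.add_mem_sup (hI a hi) (hJ b hj)
  have hdisj : Disjoint ((I ⊔ J : Ideal A) : Set A)
      ((P.primeCompl ⊔ Submonoid.powers x : Submonoid A) : Set A) := by
    rw [Set.disjoint_left]
    intro y hy hyM
    obtain ⟨t, ht, z, ⟨n, rfl⟩, rfl⟩ := Submonoid.mem_sup.mp hyM
    exact ht (hP.le (key n t hy))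
  obtain ⟨Q, hQ, hIJQ, hQM⟩ := Ideal.exists_le_prime_disjoint _ _ hdisj
  rw [Set.disjoint_left] at hQM
  have hQP : Q ≤ P := fun y hy ↦ by
    by_contra hyP
    exact hQM hy (Submonoid.mem_sup_left (S := P.primeCompl) hyP)
  exact hQM (hP.2 ⟨hQ, hIJQ⟩ hQP hxP) (Submonoid.mem_sup_right (Submonoid.mem_powers x))

/-- If `S` is a nonempty set of minimal primes and `x` lies in no minimal prime of `⋂ S + J`,
where `J` is contained in no member of `S`, then `V(⋂ S) ∩ V(x)` is not contained in `V(J)`. -/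
lemma exists_prime_sInf_le_and_mem_and_not_le {A : Type*} [CommRing A] [IsNoetherianRing A]
    [IsLocalRing A] {x : A} (hx : x ∈ IsLocalRing.maximalIdeal A)
    {S : Set (Ideal A)} (hS : S ⊆ minimalPrimes A) (hne : S.Nonempty) {J : Ideal A}
    (hJ : ∀ p ∈ S, ¬ J ≤ p) (hxP : ∀ P ∈ (sInf S ⊔ J).minimalPrimes, x ∉ P) :
    ∃ Q : Ideal A, Q.IsPrime ∧ sInf S ≤ Q ∧ x ∈ Q ∧ ¬ J ≤ Q := by
  obtain ⟨p₀, hp₀⟩ := hne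
  have hle : sInf S ⊔ Ideal.span {x} ≤ IsLocalRing.maximalIdeal A :=
    sup_le ((sInf_le hp₀).trans (IsLocalRing.le_maximalIdeal (hS hp₀).isPrime.ne_top))
      ((Ideal.span_singleton_le_iff_mem _).mpr hx)
  obtain ⟨Q, hQ, -⟩ := Ideal.exists_minimalPrimes_le hle
  have hQp : Q.IsPrime := hQ.isPrime
  have hIQ : sInf S ≤ Q := le_sup_left.trans hQ.le
  have hxQ : x ∈ Q := hQ.le (Ideal.mem_sup_right (Ideal.mem_span_singleton_self x))
  refine ⟨Q, hQp, hIQ, hxQ, fun hJQ ↦ ?_⟩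
  obtain ⟨P, hP, hPQ⟩ := Ideal.exists_minimalPrimes_le (sup_le hIQ hJQ)
  have hPp : P.IsPrime := hP.isPrime
  have hlt : P < Q := lt_of_le_of_ne hPQ fun h ↦ hxP P hP (h ▸ hxQ)
  have hIP : sInf S ≤ P := le_sup_left.trans hP.le
  have hPmin : P ∈ (Ideal.span ((sInf S : Ideal A) : Set A)).minimalPrimes := by
    refine Ideal.mem_minimalPrimes_span_of_mem_minimalPrimes_span_insert hlt x (sInf S : Ideal A)
      ?_ _ hIP ?_
    · rwa [Ideal.span_insert, Ideal.span_eq, sup_comm]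
    · exact fun a ha ↦ Ideal.le_radical (Ideal.subset_span (Set.mem_insert_of_mem x ha))
  rw [Ideal.span_eq] at hPmin
  obtain ⟨p, hp, hpP⟩ := exists_le_of_sInf_le_of_subset_minimalPrimes hS hPp hIP
  exact hJ p hp ((le_sup_right.trans hP.le).trans (hPmin.2 ⟨(hS hp).isPrime, sInf_le hp⟩ hpP))

lemma topologicalKrullDim_zeroLocus {A : Type*} [CommRing A] (K : Set A) :
    topologicalKrullDim (PrimeSpectrum.zeroLocus K) =
      Order.krullDim (PrimeSpectrum.zeroLocus K) := by
  rw [Order.krullDim_eq_of_orderIso (PrimeSpectrum.zeroLocusEquivIrreducibleCloseds K),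
    Order.krullDim_orderDual, topologicalKrullDim]

/-- If `x` lies in no minimal prime of `K`, then `dim V(K + (x)) + 1 ≤ dim V(K)`. -/
lemma topologicalKrullDim_zeroLocus_map_add_one_le {A : Type*} [CommRing A] {x : A} {K : Ideal A}
    (hxP : ∀ P ∈ K.minimalPrimes, x ∉ P) :
    topologicalKrullDim
        (PrimeSpectrum.zeroLocus ((Ideal.map (Ideal.Quotient.mk (Ideal.span {x})) K : Ideal (A ⧸ Ideal.span {x})) : Set (A ⧸ Ideal.span {x}))) + 1 ≤
      topologicalKrullDim (PrimeSpectrum.zeroLocus (K : Set A)) := by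
  rw [topologicalKrullDim_zeroLocus, topologicalKrullDim_zeroLocus]
  set f := Ideal.Quotient.mk (Ideal.span {x})
  have hmap : ∀ q : PrimeSpectrum.zeroLocus (K.map f : Set (A ⧸ Ideal.span {x})),
      K ≤ q.1.asIdeal.comap f := fun q ↦ Ideal.map_le_iff_le_comap.mp q.2
  rcases isEmpty_or_nonempty (PrimeSpectrum.zeroLocus (K.map f : Set (A ⧸ Ideal.span {x})))
    with he | hne
  · simp [Order.krullDim_eq_bot]
  have : Nonempty (PrimeSpectrum.zeroLocus (K : Set A)) :=
    hne.elim fun q ↦ ⟨⟨PrimeSpectrum.comap f q.1, hmap q⟩⟩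
  rw [Order.krullDim_eq_iSup_length, Order.krullDim_eq_iSup_length, ← WithBot.coe_one,
    ← WithBot.coe_add, ENat.iSup_add, WithBot.coe_le_coe, iSup_le_iff]
  intro l
  let g : PrimeSpectrum.zeroLocus (K.map f : Set (A ⧸ Ideal.span {x})) →
    PrimeSpectrum.zeroLocus (K : Set A) := fun q ↦ ⟨PrimeSpectrum.comap f q.1, hmap q⟩
  have hg : StrictMono g := fun q r hqr ↦ by
    refine lt_of_le_of_ne (fun a ha ↦ hqr.le ha) fun h ↦ hqr.ne ?_
    exact Subtype.ext (PrimeSpectrum.comap_injective_of_surjective f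
      Ideal.Quotient.mk_surjective (congrArg Subtype.val h))
  obtain ⟨P, hP, hPl⟩ := Ideal.exists_minimalPrimes_le (hmap l.head)
  let p : PrimeSpectrum.zeroLocus (K : Set A) := ⟨⟨P, hP.isPrime⟩, hP.le⟩
  have hlt : p < (l.map g hg).head := by
    refine lt_of_le_of_ne hPl fun h ↦ hxP P hP ?_
    have h' : P = l.head.1.asIdeal.comap f := congrArg (fun q ↦ q.1.asIdeal) h
    have hfx : f x = 0 := Ideal.Quotient.eq_zero_iff_mem.mpr (Ideal.mem_span_singleton_self x)
    rw [h', Ideal.mem_comap, hfx]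
    exact zero_mem _
  refine le_trans ?_ (le_iSup _ ((l.map g hg).cons p hlt))
  simp

/-- A prime containing `x` and `I` but not `J` gives a point of `V(I) ∖ V(I + J)` in
`Spec (A ⧸ (x))`. -/
lemma nonempty_compl_zeroLocus_map_sup_inter {A : Type*} [CommRing A] {x : A} {I J Q : Ideal A}
    (hQ : Q.IsPrime) (hIQ : I ≤ Q) (hxQ : x ∈ Q) (hJQ : ¬ J ≤ Q) :
    ((PrimeSpectrum.zeroLocus ((Ideal.map (Ideal.Quotient.mk (Ideal.span {x})) (I ⊔ J) : Ideal (A ⧸ Ideal.span {x})) : Set (A ⧸ Ideal.span {x})))ᶜ ∩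
      PrimeSpectrum.zeroLocus ((Ideal.map (Ideal.Quotient.mk (Ideal.span {x})) I : Ideal (A ⧸ Ideal.span {x})) : Set (A ⧸ Ideal.span {x}))).Nonempty := by
  have hmem : (⟨Q, hQ⟩ : PrimeSpectrum A) ∈
      Set.range (PrimeSpectrum.comap (Ideal.Quotient.mk (Ideal.span {x}))) := by
    rw [range_comap_of_surjective _ _ Ideal.Quotient.mk_surjective, Ideal.mk_ker]
    exact (Ideal.span_singleton_le_iff_mem Q).mpr hxQ
  obtain ⟨q, hq⟩ := hmem
  have hq' : q.asIdeal.comap (Ideal.Quotient.mk (Ideal.span {x})) = Q :=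
    congrArg PrimeSpectrum.asIdeal hq
  refine ⟨q, fun h ↦ hJQ ?_, ?_⟩
  · rw [← hq']
    exact le_sup_right.trans (Ideal.map_le_iff_le_comap.mp h)
  · exact Ideal.map_le_iff_le_comap.mpr (hq'.symm ▸ hIQ)

/-- Let `(A, m)` be a Noetherian complete local ring, `x ∈ m` not in
any minimal prime of `A`, `s > 0`. If `(x)` is radical and `A/(x)` is connected in
codimension `s`, then `A` is connected in codimension `s`. -/
theorem stmt13 {A : Type*} [CommRing A] [IsNoetherianRing A] [IsLocalRing A]
    [IsAdicComplete (IsLocalRing.maximalIdeal A) A]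
    (x : A) (hx : x ∈ IsLocalRing.maximalIdeal A)
    (hmin : ∀ p ∈ minimalPrimes A, x ∉ p)
    (s : ℕ) (hs : 0 < s)
    (hrad : (Ideal.span {x}).radical = Ideal.span {x})
    (hconn : ConnectedInCodim (A ⧸ Ideal.span {x}) s) :
    ConnectedInCodim A s := by
  have hxjac : x ∈ Ideal.jacobson (⊥ : Ideal A) := by
    rwa [IsLocalRing.jacobson_eq_maximalIdeal _ bot_ne_top]
  have hred := isReduced_of_radical_span_singleton hxjac hmin hrad
  have hbot : sInf (minimalPrimes A) = ⊥ :=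
    Ideal.sInf_minimalPrimes.trans (nilradical_eq_bot_iff.mpr hred)
  have hreg : ∀ a, x * a = 0 → a = 0 := fun a ha ↦ by
    have h := mem_sInf_of_mul_mem_of_notMem_minimalPrimes subset_rfl hmin
      (ha ▸ zero_mem (sInf (minimalPrimes A)))
    simpa [hbot] using h
  intro Z hZ hdim
  refine ⟨?_, isPreconnected_closed_iff.mpr fun F G hF hG hFG hZF hZG ↦ ?_⟩
  · rw [Set.nonempty_compl]
    rintro rfl
    rw [(Homeomorph.Set.univ _).isHomeomorph.topologicalKrullDim_eq,
      PrimeSpectrum.topologicalKrullDim_eq_ringKrullDim] at hdim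
    exact absurd hdim (not_lt.mpr (le_add_of_nonneg_right (WithBot.coe_le_coe.mpr bot_le)))
  by_contra hFGZ
  have hFGZ' : ∀ q, q ∈ F → q ∈ G → q ∈ Z := fun q hqF hqG ↦ by
    by_contra hqZ
    exact hFGZ ⟨q, hqZ, hqF, hqG⟩
  have hspec : ∀ {T : Set (PrimeSpectrum A)}, IsClosed T → ∀ {p q : PrimeSpectrum A},
      p ≤ q → p ∈ T → q ∈ T := fun hT p q hpq hp ↦
    ((PrimeSpectrum.le_iff_specializes p q).mp hpq).mem_closed hT hp
  let U : Set (Ideal A) :=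
    {p | ∃ h : p ∈ minimalPrimes A, (⟨p, h.isPrime⟩ : PrimeSpectrum A) ∈ F ∪ Z}
  let V : Set (Ideal A) := minimalPrimes A \ U
  have hU : U ⊆ minimalPrimes A := fun p hp ↦ hp.1
  have hV : V ⊆ minimalPrimes A := Set.sdiff_subset
  have hUFZ : ∀ q : PrimeSpectrum A, ∀ p ∈ U, p ≤ q.asIdeal → q ∈ F ∪ Z :=
    fun q p ⟨hp, hpF⟩ hpq ↦ hspec (hF.union hZ) (p := ⟨p, hp.isPrime⟩) hpq hpF
  have hVG : ∀ q : PrimeSpectrum A, ∀ p ∈ V, p ≤ q.asIdeal → q ∈ G := by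
    intro q p ⟨hp, hpU⟩ hpq
    have hpFZ : (⟨p, hp.isPrime⟩ : PrimeSpectrum A) ∉ F ∪ Z := fun h ↦ hpU ⟨hp, h⟩
    exact hspec hG (p := ⟨p, hp.isPrime⟩) hpq
      ((hFG fun h ↦ hpFZ (Or.inr h)).resolve_left fun h ↦ hpFZ (Or.inl h))
  have hUne : U.Nonempty := by
    obtain ⟨q, hqZ, hqF⟩ := hZF
    obtain ⟨p, hp, hpq⟩ := Ideal.exists_minimalPrimes_le (bot_le : ⊥ ≤ q.asIdeal)
    by_contra hne
    exact hqZ (hFGZ' q hqF (hVG q p ⟨hp, fun h ↦ hne ⟨p, h⟩⟩ hpq))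
  have hVne : V.Nonempty := by
    obtain ⟨q, hqZ, hqG⟩ := hZG
    obtain ⟨p, hp, hpq⟩ := Ideal.exists_minimalPrimes_le (bot_le : ⊥ ≤ q.asIdeal)
    by_contra hne
    have hpU : p ∈ U := by
      by_contra h
      exact hne ⟨p, hp, h⟩
    exact (hUFZ q p hpU hpq).elim (fun h ↦ hqZ (hFGZ' q h hqG)) hqZ
  have hVU : ∀ p ∈ U, ¬ sInf V ≤ p := fun p hp hle ↦ by
    obtain ⟨p', hp', hpp'⟩ :=
      exists_le_of_sInf_le_of_subset_minimalPrimes hV (hU hp).isPrime hle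
    exact hp'.2 ((hpp'.antisymm ((hU hp).2 ⟨(hV hp').isPrime, bot_le⟩ hpp')) ▸ hp)
  have hUV : ∀ p ∈ V, ¬ sInf U ≤ p := fun p hp hle ↦ by
    obtain ⟨p', hp', hpp'⟩ :=
      exists_le_of_sInf_le_of_subset_minimalPrimes hU (hV hp).isPrime hle
    exact hp.2 ((hpp'.antisymm ((hV hp).2 ⟨(hU hp').isPrime, bot_le⟩ hpp')) ▸ hp')
  have hmul : ∀ i ∈ sInf U, ∀ j ∈ sInf V, i * j = 0 := fun i hi j hj ↦ by
    rw [← Ideal.mem_bot, ← hbot, Ideal.mem_sInf]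
    intro p hp
    by_cases hpU : p ∈ U
    · exact p.mul_mem_right j (Ideal.mem_sInf.mp hi hpU)
    · exact p.mul_mem_left i (Ideal.mem_sInf.mp hj (show p ∈ V from ⟨hp, hpU⟩))
  have hxP : ∀ P ∈ (sInf U ⊔ sInf V).minimalPrimes, x ∉ P := fun P hP ↦
    notMem_of_mem_minimalPrimes_sup hreg hrad
      (fun _ ↦ mem_sInf_of_mul_mem_of_notMem_minimalPrimes hU hmin)
      (fun _ ↦ mem_sInf_of_mul_mem_of_notMem_minimalPrimes hV hmin) hmul hP
  have hsub : PrimeSpectrum.zeroLocus ((sInf U ⊔ sInf V : Ideal A) : Set A) ⊆ Z := fun q hq ↦ by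
    obtain ⟨p, hp, hpq⟩ :=
      exists_le_of_sInf_le_of_subset_minimalPrimes hU q.2 (le_sup_left.trans hq)
    obtain ⟨p', hp', hpq'⟩ :=
      exists_le_of_sInf_le_of_subset_minimalPrimes hV q.2 (le_sup_right.trans hq)
    exact (hUFZ q p hp hpq).elim (fun h ↦ hFGZ' q h (hVG q p' hp' hpq')) id
  have hle : topologicalKrullDim (PrimeSpectrum.zeroLocus ((sInf U ⊔ sInf V : Ideal A) : Set A)) ≤
      topologicalKrullDim Z :=
    (Topology.IsEmbedding.inclusion hsub).isInducing.topologicalKrullDim_le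
  have hdimA : ringKrullDim A ≤ ringKrullDim (A ⧸ Ideal.span {x}) + 1 := by
    have h := ringKrullDim_le_ringKrullDim_quotient_add_card ({x} : Finset A)
      (by simpa [IsLocalRing.ringJacobson_eq_maximalIdeal] using hx)
    rwa [Finset.coe_singleton, Finset.card_singleton, Nat.cast_one] at h
  set f := Ideal.Quotient.mk (Ideal.span {x})
  have hconn' := hconn _ (PrimeSpectrum.isClosed_zeroLocus
    (((sInf U ⊔ sInf V).map f : Ideal (A ⧸ Ideal.span {x})) : Set (A ⧸ Ideal.span {x}))) <| by
      by_contra! hlt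
      refine absurd hdim (not_lt.mpr (hdimA.trans ?_))
      calc ringKrullDim (A ⧸ Ideal.span {x}) + 1 ≤ _ := add_le_add_left hlt 1
        _ = _ := add_right_comm _ _ _
        _ ≤ _ := add_le_add_left
          ((topologicalKrullDim_zeroLocus_map_add_one_le hxP).trans hle) _
  obtain ⟨Q, hQ, hUQ, hxQ, hVQ⟩ :=
    exists_prime_sInf_le_and_mem_and_not_le hx hU hUne hVU hxP
  obtain ⟨Q', hQ', hVQ', hxQ', hUQ'⟩ :=
    exists_prime_sInf_le_and_mem_and_not_le hx hV hVne hUV (sup_comm (sInf U) (sInf V) ▸ hxP)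
  obtain ⟨q, hq, hqU, hqV⟩ := isPreconnected_closed_iff.mp hconn'.isPreconnected _ _
    (PrimeSpectrum.isClosed_zeroLocus
      (((sInf U).map f : Ideal (A ⧸ Ideal.span {x})) : Set (A ⧸ Ideal.span {x})))
    (PrimeSpectrum.isClosed_zeroLocus
      (((sInf V).map f : Ideal (A ⧸ Ideal.span {x})) : Set (A ⧸ Ideal.span {x})))
    (fun q _ ↦ by
      have hmulq : sInf U * sInf V ≤ q.asIdeal.comap f :=
        Ideal.mul_le.mpr fun i hi j hj ↦ hmul i hi j hj ▸ zero_mem _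
      exact ((inferInstance : (q.asIdeal.comap f).IsPrime).mul_le.mp hmulq).imp
        Ideal.map_le_iff_le_comap.mpr Ideal.map_le_iff_le_comap.mpr)
    (nonempty_compl_zeroLocus_map_sup_inter hQ hUQ hxQ hVQ)
    (sup_comm (sInf U) (sInf V) ▸ nonempty_compl_zeroLocus_map_sup_inter hQ' hVQ' hxQ' hUQ')
  refine hq ?_
  rw [Ideal.map_sup]
  exact sup_le (a := (sInf U).map f) (b := (sInf V).map f) (c := q.asIdeal) hqU hqV

end
end

section
/- Let k be a field, n ≥ 1, and J = (X², XY, Y², YZⁿ − XWⁿ) ⊆ P = k[X, Y, Z, W]. Then J is an (X, Y)-primary ideal; in particular J is unmixed of height 2, and its radical is (X, Y). -/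
noncomputable section

open MvPolynomial

/-- The height of an ideal: the infimum of heights of primes containing it. -/
def idealHeight {A : Type*} [CommRing A] (I : Ideal A) : ℕ∞ :=
  ⨅ p : {p : PrimeSpectrum A // I ≤ p.asIdeal}, Order.height p.1

/-- The ideal `J = (X², XY, Y², YZⁿ − XWⁿ)` in `P = k[X, Y, Z, W]`, where
`X = X 0, Y = X 1, Z = X 2, W = X 3`. -/
def Jn (k : Type*) [Field k] (n : ℕ) : Ideal (MvPolynomial (Fin 4) k) :=
  Ideal.span {X 0 ^ 2, X 0 * X 1, X 1 ^ 2,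
    X 1 * X 2 ^ n - X 0 * X 3 ^ n}

/-- The zero ideal of the dual numbers over a domain is primary. -/
lemma DualNumber.isPrimary_bot (A : Type*) [CommRing A] [IsDomain A] :
    (⊥ : Ideal (DualNumber A)).IsPrimary := by
  rw [Ideal.isPrimary_iff]
  refine ⟨bot_ne_top, fun {x y} hxy => ?_⟩
  rw [Ideal.mem_bot] at hxy
  have hfst : x.fst * y.fst = 0 := by simpa using congrArg TrivSqZeroExt.fst hxy
  have hsnd : x.fst * y.snd + x.snd * y.fst = 0 := by
    simpa using congrArg TrivSqZeroExt.snd hxy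
  by_cases hy : y.fst = 0
  · right
    refine ⟨2, ?_⟩
    rw [Ideal.mem_bot]
    ext <;> simp [pow_two, hy]
  · left
    have hx : x.fst = 0 := (mul_eq_zero.mp hfst).resolve_right hy
    rw [hx, zero_mul, zero_add] at hsnd
    rw [Ideal.mem_bot]
    ext
    · simpa using hx
    · simpa using (mul_eq_zero.mp hsnd).resolve_right hy

/-- The height of a prime ideal in the sense of `idealHeight` is its Mathlib height. -/
lemma idealHeight_eq_height {A : Type*} [CommRing A] (p : Ideal A) [hp : p.IsPrime] :
    idealHeight p = p.height := by
  rw [show p.height = Order.height (⟨p, hp⟩ : PrimeSpectrum A) from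
    PrimeSpectrum.height_eq_orderHeight ⟨p, hp⟩]
  exact le_antisymm (iInf_le _ (⟨⟨p, hp⟩, le_rfl⟩ : {q : PrimeSpectrum A // p ≤ q.asIdeal}))
    (le_iInf fun q => Order.height_mono q.2)

lemma idealHeight_radical {A : Type*} [CommRing A] (I : Ideal A) :
    idealHeight I.radical = idealHeight I :=
  le_antisymm
    (le_iInf fun q => iInf_le_of_le ⟨q.1, q.1.2.radical_le_iff.mpr q.2⟩ le_rfl)
    (le_iInf fun q => iInf_le_of_le ⟨q.1, Ideal.le_radical.trans q.2⟩ le_rfl)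

/-- An ideal `(X i, X j)` with `i ≠ j` has height two once it is known to be prime. -/
lemma MvPolynomial.height_span_X_pair {k σ : Type*} [Field k] [Finite σ] {i j : σ} (hij : i ≠ j)
    [hp : (Ideal.span {(X i : MvPolynomial σ k), X j}).IsPrime] :
    (Ideal.span {(X i : MvPolynomial σ k), X j}).height = 2 := by
  apply le_antisymm
  · have h := Ideal.height_le_card_of_mem_minimalPrimes_span
      (s := {(X i : MvPolynomial σ k), X j}) (Set.toFinite _)
      (by rw [Ideal.minimalPrimes_eq_subsingleton_self]; rfl)
    rwa [Set.ncard_pair (fun h => hij (X_injective h))] at h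
  · have : (Ideal.span {(X i : MvPolynomial σ k)}).IsPrime :=
      (Ideal.span_singleton_prime (X_ne_zero i)).mpr X_prime
    have hlt : Ideal.span {(X i : MvPolynomial σ k)} < Ideal.span {X i, X j} := by
      refine lt_of_le_of_ne (Ideal.span_mono (by simp)) fun h => hij ?_
      have hj : (X j : MvPolynomial σ k) ∈ Ideal.span {(X i : MvPolynomial σ k)} :=
        h ▸ Ideal.subset_span (by simp)
      simpa using X_dvd_X.mp (Ideal.mem_span_singleton.mp hj)
    have h₁ := Ideal.one_le_height_span_singleton_of_mem_nonZeroDivisors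
      (mem_nonZeroDivisors_of_ne_zero (X_ne_zero (R := k) i))
    calc (2 : ℕ∞) = 1 + 1 := by norm_num
      _ ≤ (Ideal.span {(X i : MvPolynomial σ k)}).height + 1 := by gcongr
      _ ≤ _ := Ideal.height_add_one_le_of_lt_of_isPrime hlt

/-- The map `k[X, Y, Z, W] → k[X, Y, Z, W][ε]` sending `X ↦ Zⁿε`, `Y ↦ Wⁿε`, `Z ↦ Z`, `W ↦ W`,
whose kernel is `Jn k n`. -/
def toDualNumber (k : Type*) [Field k] (n : ℕ) :
    MvPolynomial (Fin 4) k →ₐ[k] DualNumber (MvPolynomial (Fin 4) k) :=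
  aeval ![TrivSqZeroExt.inr (X 2 ^ n), TrivSqZeroExt.inr (X 3 ^ n),
    TrivSqZeroExt.inl (X 2), TrivSqZeroExt.inl (X 3)]

section

variable {k : Type*} [Field k] (n : ℕ)

lemma toDualNumber_X_zero : toDualNumber k n (X 0) = TrivSqZeroExt.inr (X 2 ^ n) := by
  simp [toDualNumber]

lemma toDualNumber_X_one : toDualNumber k n (X 1) = TrivSqZeroExt.inr (X 3 ^ n) := by
  simp [toDualNumber]

lemma toDualNumber_X_two : toDualNumber k n (X 2) = TrivSqZeroExt.inl (X 2) := by
  simp [toDualNumber]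

lemma toDualNumber_X_three : toDualNumber k n (X 3) = TrivSqZeroExt.inl (X 3) := by
  simp [toDualNumber]

lemma toDualNumber_C (a : k) : toDualNumber k n (C a) = TrivSqZeroExt.inl (C a) := by
  simp only [toDualNumber, aeval_C]
  rfl

lemma Jn_le_ker : Jn k n ≤ RingHom.ker (toDualNumber k n) := by
  rw [Jn, Ideal.span_le]
  rintro f (rfl | rfl | rfl | rfl) <;>
    simp only [SetLike.mem_coe, RingHom.mem_ker, map_sub, map_mul, map_pow, toDualNumber_X_zero,
      toDualNumber_X_one, toDualNumber_X_two, toDualNumber_X_three] <;>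
    ext <;> simp [pow_two, mul_comm]

/-- Taylor expansion of a polynomial to first order in `X` and `Y`: the coefficients are fixed by
`toDualNumber` and the remainder lies in `(X, Y)² ⊆ Jn k n`. -/
lemma exists_sub_mem_Jn (f : MvPolynomial (Fin 4) k) :
    ∃ a b c : MvPolynomial (Fin 4) k,
      toDualNumber k n a = TrivSqZeroExt.inl a ∧ toDualNumber k n b = TrivSqZeroExt.inl b ∧
      toDualNumber k n c = TrivSqZeroExt.inl c ∧ f - (a + b * X 0 + c * X 1) ∈ Jn k n := by
  have h₀ : (X 0 ^ 2 : MvPolynomial (Fin 4) k) ∈ Jn k n := Ideal.subset_span (by simp)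
  have h₁ : (X 0 * X 1 : MvPolynomial (Fin 4) k) ∈ Jn k n := Ideal.subset_span (by simp)
  have h₂ : (X 1 ^ 2 : MvPolynomial (Fin 4) k) ∈ Jn k n := Ideal.subset_span (by simp)
  induction f using MvPolynomial.induction_on with
  | C r => exact ⟨C r, 0, 0, toDualNumber_C n r, by simp, by simp, by simp⟩
  | add f g hf hg =>
    obtain ⟨a, b, c, ha, hb, hc, h⟩ := hf
    obtain ⟨a', b', c', ha', hb', hc', h'⟩ := hg
    refine ⟨a + a', b + b', c + c', by simp [ha, ha'], by simp [hb, hb'], by simp [hc, hc'], ?_⟩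
    convert add_mem h h' using 1
    ring
  | mul_X f i hf =>
    obtain ⟨a, b, c, ha, hb, hc, h⟩ := hf
    have hX := Ideal.mul_mem_right (X i) _ h
    fin_cases i
    · refine ⟨0, a, 0, by simp, ha, by simp, ?_⟩
      convert add_mem hX (add_mem (Ideal.mul_mem_left _ b h₀) (Ideal.mul_mem_left _ c h₁)) using 1
      simp only [Fin.zero_eta]
      ring
    · refine ⟨0, 0, a, by simp, by simp, ha, ?_⟩
      convert add_mem hX (add_mem (Ideal.mul_mem_left _ b h₁) (Ideal.mul_mem_left _ c h₂)) using 1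
      simp only [Fin.mk_one]
      ring
    · refine ⟨a * X 2, b * X 2, c * X 2, by simp [ha, toDualNumber_X_two],
        by simp [hb, toDualNumber_X_two], by simp [hc, toDualNumber_X_two], ?_⟩
      convert hX using 1
      simp only [Fin.reduceFinMk]
      ring
    · refine ⟨a * X 3, b * X 3, c * X 3, by simp [ha, toDualNumber_X_three],
        by simp [hb, toDualNumber_X_three], by simp [hc, toDualNumber_X_three], ?_⟩
      convert hX using 1
      simp only [Fin.reduceFinMk]
      ring

lemma toDualNumber_eq {f a b c : MvPolynomial (Fin 4) k}
    (ha : toDualNumber k n a = TrivSqZeroExt.inl a) (hb : toDualNumber k n b = TrivSqZeroExt.inl b)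
    (hc : toDualNumber k n c = TrivSqZeroExt.inl c) (h : f - (a + b * X 0 + c * X 1) ∈ Jn k n) :
    toDualNumber k n f =
      TrivSqZeroExt.inl a + TrivSqZeroExt.inr (b * X 2 ^ n + c * X 3 ^ n) := by
  have h0 : toDualNumber k n (f - (a + b * X 0 + c * X 1)) = 0 := Jn_le_ker n h
  rw [map_sub, sub_eq_zero] at h0
  rw [h0]
  simp only [map_add, map_mul, ha, hb, hc, toDualNumber_X_zero, toDualNumber_X_one]
  ext <;> simp [mul_comm]

lemma ker_toDualNumber : RingHom.ker (toDualNumber k n) = Jn k n := by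
  refine le_antisymm (fun f hf => ?_) (Jn_le_ker n)
  obtain ⟨a, b, c, ha, hb, hc, h⟩ := exists_sub_mem_Jn n f
  have hφ := toDualNumber_eq n ha hb hc h
  rw [(RingHom.mem_ker).mp hf] at hφ
  have ha0 : a = 0 := by simpa using (congrArg TrivSqZeroExt.fst hφ).symm
  have hbc : b * X 2 ^ n + c * X 3 ^ n = 0 := by
    simpa using (congrArg TrivSqZeroExt.snd hφ).symm
  have hdvd : (X 3 ^ n : MvPolynomial (Fin 4) k) ∣ b * X 2 ^ n :=
    ⟨-c, by linear_combination hbc⟩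
  have hX : ¬ (X 3 : MvPolynomial (Fin 4) k) ∣ X 2 ^ n := fun h =>
    absurd (X_dvd_X.mp (X_prime.dvd_of_dvd_pow h)) (by decide)
  obtain ⟨d, rfl⟩ := X_prime.pow_dvd_of_dvd_mul_right n hX hdvd
  have hc' : c = -d * X 2 ^ n := by
    refine mul_right_cancel₀ (pow_ne_zero n (X_ne_zero (R := k) (3 : Fin 4))) ?_
    linear_combination hbc
  have hgen : (X 1 * X 2 ^ n - X 0 * X 3 ^ n : MvPolynomial (Fin 4) k) ∈ Jn k n :=
    Ideal.subset_span (by simp)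
  convert add_mem h (Ideal.mul_mem_left _ (-d) hgen) using 1
  rw [ha0, hc']
  ring

lemma isPrimary_Jn : (Jn k n).IsPrimary := by
  rw [← ker_toDualNumber]
  exact (DualNumber.isPrimary_bot (MvPolynomial (Fin 4) k)).comap (toDualNumber k n).toRingHom

lemma Jn_le_span : Jn k n ≤ Ideal.span {X 0, X 1} := by
  have h₀ : (X 0 : MvPolynomial (Fin 4) k) ∈ Ideal.span {X 0, X 1} :=
    Ideal.subset_span (by simp)
  have h₁ : (X 1 : MvPolynomial (Fin 4) k) ∈ Ideal.span {X 0, X 1} :=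
    Ideal.subset_span (by simp)
  rw [Jn, Ideal.span_le]
  rintro f (rfl | rfl | rfl | rfl)
  · exact Ideal.pow_mem_of_mem _ h₀ 2 two_pos
  · exact Ideal.mul_mem_right _ _ h₀
  · exact Ideal.pow_mem_of_mem _ h₁ 2 two_pos
  · exact sub_mem (Ideal.mul_mem_right _ _ h₁) (Ideal.mul_mem_right _ _ h₀)

lemma radical_Jn : (Jn k n).radical = Ideal.span {X 0, X 1} := by
  apply le_antisymm
  · rintro f ⟨m, hm⟩
    obtain ⟨a, b, c, ha, hb, hc, h⟩ := exists_sub_mem_Jn n f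
    have hpow : toDualNumber k n f ^ m = 0 := by
      rw [← map_pow]
      exact Jn_le_ker n hm
    have ha0 : a = 0 := by
      have h0 := congrArg TrivSqZeroExt.fst hpow
      rw [toDualNumber_eq n ha hb hc h, TrivSqZeroExt.fst_pow] at h0
      exact eq_zero_of_pow_eq_zero (by simpa using h0)
    have hbc : b * X 0 + c * X 1 ∈ Ideal.span {(X 0 : MvPolynomial (Fin 4) k), X 1} :=
      Ideal.mem_span_pair.mpr ⟨b, c, rfl⟩
    convert add_mem (Jn_le_span n h) hbc using 1
    rw [ha0]
    ring
  · rw [Ideal.span_le]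
    rintro f (rfl | rfl)
    · exact ⟨2, Ideal.subset_span (by simp)⟩
    · exact ⟨2, Ideal.subset_span (by simp)⟩

end

/-- For any field `k` and `n ≥ 1`, the ideal
`J = (X², XY, Y², YZⁿ − XWⁿ) ⊆ k[X,Y,Z,W]` is `(X, Y)`-primary; in particular `J` is
unmixed of height `2` and `√J = (X, Y)`. -/
theorem stmt17 (k : Type*) [Field k] (n : ℕ) (hn : 1 ≤ n) :
    (Jn k n).IsPrimary ∧
    (Jn k n).radical = Ideal.span {(X 0 : MvPolynomial (Fin 4) k), X 1} ∧
    idealHeight (Jn k n) = 2 ∧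
    (∀ p ∈ associatedPrimes (MvPolynomial (Fin 4) k)
        (MvPolynomial (Fin 4) k ⧸ Jn k n), idealHeight p = 2) := by
  have hrad := radical_Jn (k := k) n
  have hprime : (Ideal.span {(X 0 : MvPolynomial (Fin 4) k), X 1}).IsPrime :=
    hrad ▸ Ideal.isPrime_radical (isPrimary_Jn n)
  have hheight : idealHeight (Ideal.span {(X 0 : MvPolynomial (Fin 4) k), X 1}) = 2 := by
    rw [idealHeight_eq_height, height_span_X_pair (by decide)]
  refine ⟨isPrimary_Jn n, hrad, ?_, fun p hp => ?_⟩
  · rw [← idealHeight_radical, hrad, hheight]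
  · rw [IsAssociatedPrime.eq_radical (isPrimary_Jn n) hp, hrad, hheight]

end
end

section
/- Let k be a field, n ≥ 1, and G = k[X, Y, Z, W]/(X², XY, Y², YZⁿ − XWⁿ). Then the Hilbert series of G equals (1 + 2t − t^{n+1})/(1 − t)². Consequently G has dimension 2, multiplicity e₀(G) = 2, and first Hilbert coefficient e₁(G) = 1 − n. -/
noncomputable section

open MvPolynomial

/-- The Hilbert function of `G = P/J`: the `k`-dimension of the degree-`j` graded
piece, i.e. of the image of the space of degree-`j` homogeneous polynomials in `G`. -/
def hilbFn (k : Type*) [Field k] (n : ℕ) (j : ℕ) : ℕ :=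
  Module.finrank k ↥(Submodule.map (Ideal.Quotient.mkₐ k (Jn k n)).toLinearMap
    (homogeneousSubmodule (Fin 4) k j))

/-- The numerator `h(t) = 1 + 2t − t^{n+1}` of the Hilbert series. -/
def hpoly (n : ℕ) : Polynomial ℤ :=
  1 + 2 * Polynomial.X - Polynomial.X ^ (n + 1)

/-- The algebra map `k[X, Y, Z, W] → k[z, w][ε]` sending `X ↦ zⁿ ε`, `Y ↦ wⁿ ε`, `Z ↦ z`,
`W ↦ w`. Its kernel is `Jn k n`. -/
def dualMap (k : Type*) [Field k] (n : ℕ) :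
    MvPolynomial (Fin 4) k →ₐ[k] DualNumber (MvPolynomial (Fin 2) k) :=
  aeval ![TrivSqZeroExt.inr (X 0 ^ n), TrivSqZeroExt.inr (X 1 ^ n),
    TrivSqZeroExt.inl (X 0), TrivSqZeroExt.inl (X 1)]

/-- The inclusion `k[z, w] → k[X, Y, Z, W]` with `z ↦ Z`, `w ↦ W`. -/
def baseMap (k : Type*) [Field k] : MvPolynomial (Fin 2) k →ₐ[k] MvPolynomial (Fin 4) k :=
  aeval ![X 2, X 3]

section

variable {k : Type*} [Field k] {n : ℕ}

lemma dualMap_X_zero : dualMap k n (X 0) = TrivSqZeroExt.inr (X 0 ^ n) := by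
  simp [dualMap]

lemma dualMap_X_one : dualMap k n (X 1) = TrivSqZeroExt.inr (X 1 ^ n) := by
  simp [dualMap]

lemma dualMap_X_two : dualMap k n (X 2) = TrivSqZeroExt.inl (X 0) := by
  simp [dualMap]

lemma dualMap_X_three : dualMap k n (X 3) = TrivSqZeroExt.inl (X 1) := by
  simp [dualMap]

lemma dualMap_baseMap (a : MvPolynomial (Fin 2) k) :
    dualMap k n (baseMap k a) = TrivSqZeroExt.inl a := by
  have : (dualMap k n).comp (baseMap k) =
      TrivSqZeroExt.inlAlgHom k (MvPolynomial (Fin 2) k) (MvPolynomial (Fin 2) k) := by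
    ext i : 1
    fin_cases i <;> simp [baseMap, dualMap_X_two, dualMap_X_three]
  exact DFunLike.congr_fun this a

lemma Jn_le_ker_dualMap : Jn k n ≤ RingHom.ker (dualMap k n) := by
  rw [Jn, Ideal.span_le]
  rintro p (rfl | rfl | rfl | rfl) <;>
    simp only [SetLike.mem_coe, RingHom.mem_ker, map_sub, map_mul, map_pow, dualMap_X_zero,
      dualMap_X_one, dualMap_X_two, dualMap_X_three, pow_two, TrivSqZeroExt.inr_mul_inr]
  rw [TrivSqZeroExt.inl_pow, TrivSqZeroExt.inl_pow, TrivSqZeroExt.inr_mul_inl,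
    TrivSqZeroExt.inr_mul_inl, op_smul_eq_smul, op_smul_eq_smul,
    smul_eq_mul, smul_eq_mul, mul_comm, sub_self]

lemma X_zero_sq_mem : (X 0 ^ 2 : MvPolynomial (Fin 4) k) ∈ Jn k n :=
  Ideal.subset_span (by simp)

lemma X_zero_mul_X_one_mem : (X 0 * X 1 : MvPolynomial (Fin 4) k) ∈ Jn k n :=
  Ideal.subset_span (by simp)

lemma X_one_sq_mem : (X 1 ^ 2 : MvPolynomial (Fin 4) k) ∈ Jn k n :=
  Ideal.subset_span (by simp)

lemma relation_mem :
    (X 1 * X 2 ^ n - X 0 * X 3 ^ n : MvPolynomial (Fin 4) k) ∈ Jn k n :=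
  Ideal.subset_span (by simp)

lemma exists_normalForm (p : MvPolynomial (Fin 4) k) :
    ∃ a b c : MvPolynomial (Fin 2) k,
      p - (baseMap k a + baseMap k b * X 0 + baseMap k c * X 1) ∈ Jn k n := by
  induction p using MvPolynomial.induction_on with
  | C r => exact ⟨C r, 0, 0, by simp [baseMap, algebraMap_eq]⟩
  | add p q hp hq =>
    obtain ⟨a, b, c, h⟩ := hp
    obtain ⟨a', b', c', h'⟩ := hq
    refine ⟨a + a', b + b', c + c', ?_⟩
    convert! add_mem h h' using 1
    simp only [map_add]
    ring
  | mul_X p i hp =>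
    obtain ⟨a, b, c, h⟩ := hp
    have hmul := Ideal.mul_mem_right (X i) _ h
    match i with
    | 0 =>
      refine ⟨0, a, 0, ?_⟩
      convert! add_mem hmul (add_mem (Ideal.mul_mem_left _ (baseMap k b) X_zero_sq_mem)
        (Ideal.mul_mem_left _ (baseMap k c) X_zero_mul_X_one_mem)) using 1
      simp only [map_zero]
      ring
    | 1 =>
      refine ⟨0, 0, a, ?_⟩
      convert! add_mem hmul (add_mem (Ideal.mul_mem_left _ (baseMap k b) X_zero_mul_X_one_mem)
        (Ideal.mul_mem_left _ (baseMap k c) X_one_sq_mem)) using 1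
      simp only [map_zero]
      ring
    | 2 =>
      refine ⟨a * X 0, b * X 0, c * X 0, ?_⟩
      convert! hmul using 1
      have : baseMap k (X 0) = X 2 := by simp [baseMap]
      simp only [map_mul, this]
      ring
    | 3 =>
      refine ⟨a * X 1, b * X 1, c * X 1, ?_⟩
      convert! hmul using 1
      have : baseMap k (X 1) = X 3 := by simp [baseMap]
      simp only [map_mul, this]
      ring

lemma exists_of_syzygy {b c : MvPolynomial (Fin 2) k}
    (h : b * X 0 ^ n + c * X 1 ^ n = 0) : ∃ e, b = -(e * X 1 ^ n) ∧ c = e * X 0 ^ n := by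
  have hX : ¬ (X 0 : MvPolynomial (Fin 2) k) ∣ X 1 ^ n := fun hd ↦ by
    have := (X_prime (R := k) (i := (0 : Fin 2))).dvd_of_dvd_pow hd
    rw [X_dvd_X] at this
    simp at this
  obtain ⟨e, rfl⟩ : X 0 ^ n ∣ c :=
    (X_prime (R := k) (i := (0 : Fin 2))).pow_dvd_of_dvd_mul_right n hX
      ⟨-b, by linear_combination h⟩
  refine ⟨e, ?_, mul_comm _ _⟩
  have h0 : (X 0 ^ n : MvPolynomial (Fin 2) k) ≠ 0 := pow_ne_zero _ (X_ne_zero _)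
  apply mul_right_cancel₀ h0
  linear_combination h

lemma ker_dualMap : RingHom.ker (dualMap k n) = Jn k n := by
  refine le_antisymm (fun p hp ↦ ?_) Jn_le_ker_dualMap
  obtain ⟨a, b, c, h⟩ := exists_normalForm (n := n) p
  have hker := Jn_le_ker_dualMap h
  rw [RingHom.mem_ker] at hp hker
  rw [map_sub, hp, zero_sub, neg_eq_zero] at hker
  simp only [map_add, map_mul, dualMap_baseMap, dualMap_X_zero, dualMap_X_one,
    TrivSqZeroExt.inl_mul_inr, smul_eq_mul] at hker
  have ha : a = 0 := by simpa using congrArg TrivSqZeroExt.fst hker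
  have hbc : b * X 0 ^ n + c * X 1 ^ n = 0 := by
    simpa using congrArg TrivSqZeroExt.snd hker
  obtain ⟨e, rfl, rfl⟩ := exists_of_syzygy hbc
  subst ha
  convert! add_mem h (Ideal.mul_mem_left _ (baseMap k e) (relation_mem (n := n))) using 1
  have h0 : baseMap k (X 0) = X 2 := by simp [baseMap]
  have h1 : baseMap k (X 1) = X 3 := by simp [baseMap]
  simp only [map_zero, map_neg, map_mul, map_pow, h0, h1]
  ring

lemma hilbFn_eq_finrank_map_dualMap (j : ℕ) :
    hilbFn k n j = Module.finrank k
      ↥((homogeneousSubmodule (Fin 4) k j).map (dualMap k n).toLinearMap) := by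
  let g : (MvPolynomial (Fin 4) k ⧸ Jn k n) →ₐ[k] DualNumber (MvPolynomial (Fin 2) k) :=
    Ideal.Quotient.liftₐ (Jn k n) (dualMap k n) fun a ha ↦ Jn_le_ker_dualMap ha
  have hg : Function.Injective g.toLinearMap := by
    refine (injective_iff_map_eq_zero g).2 fun a ha ↦ ?_
    obtain ⟨p, rfl⟩ := Ideal.Quotient.mk_surjective a
    exact Ideal.Quotient.eq_zero_iff_mem.2 (ker_dualMap.le ha)
  have hcomp : (dualMap k n).toLinearMap =
      g.toLinearMap ∘ₗ (Ideal.Quotient.mkₐ k (Jn k n)).toLinearMap := rfl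
  rw [hilbFn, hcomp, Submodule.map_comp]
  exact (Submodule.equivMapOfInjective _ hg _).finrank_eq

/-- The exponent vector of the monomial `zᵃ wᵇ`. -/
def expPair (a b : ℕ) : Fin 2 →₀ ℕ := Finsupp.equivFunOnFinite.symm ![a, b]

lemma expPair_injective {a b a' b' : ℕ} (h : expPair a b = expPair a' b') : a = a' ∧ b = b' :=
  ⟨DFunLike.congr_fun h 0, DFunLike.congr_fun h 1⟩

lemma monomial_expPair (a b : ℕ) :
    (monomial (expPair a b) 1 : MvPolynomial (Fin 2) k) = X 0 ^ a * X 1 ^ b := by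
  rw [monomial_eq, Finsupp.prod_fintype _ _ (by simp)]
  simp [expPair]

/-- The exponents `a` of the monomials `zᵃ wᵇ` of degree `j + n - 1` in `(zⁿ, wⁿ)`. -/
def epsExponents (n j : ℕ) : Finset ℕ := {a ∈ Finset.range (j + n) | n ≤ a ∨ a < j}

lemma card_epsExponents (n j : ℕ) : (epsExponents n j).card = 2 * j - (j - n) := by
  have : epsExponents n j = Finset.range j ∪ Finset.Ico n (j + n) := by
    ext a
    simp only [epsExponents, Finset.mem_filter, Finset.mem_union, Finset.mem_range,
      Finset.mem_Ico]
    omega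
  have h := Finset.card_union_add_card_inter (Finset.range j) (Finset.Ico n (j + n))
  have hi : Finset.range j ∩ Finset.Ico n (j + n) = Finset.Ico n j := by
    ext a
    simp only [Finset.mem_inter, Finset.mem_range, Finset.mem_Ico]
    omega
  rw [hi, Finset.card_range, Nat.card_Ico, Nat.card_Ico] at h
  rw [this]
  omega

/-- A `k`-basis of the image of the degree `j` polynomials under `dualMap`. -/
def imageBasis (k : Type*) [Field k] (n j : ℕ) :
    Fin (j + 1) ⊕ epsExponents n j → DualNumber (MvPolynomial (Fin 2) k) :=
  Sum.elim (fun a ↦ TrivSqZeroExt.inl (X 0 ^ (a : ℕ) * X 1 ^ (j - a)))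
    (fun a ↦ TrivSqZeroExt.inr (X 0 ^ (a : ℕ) * X 1 ^ (j + n - 1 - a)))

lemma linearIndependent_imageBasis (j : ℕ) : LinearIndependent k (imageBasis k n j) := by
  let B : Module.Basis _ k (MvPolynomial (Fin 2) k × MvPolynomial (Fin 2) k) :=
    (basisMonomials (Fin 2) k).prod (basisMonomials (Fin 2) k)
  let e : Fin (j + 1) ⊕ epsExponents n j → (Fin 2 →₀ ℕ) ⊕ (Fin 2 →₀ ℕ) :=
    Sum.map (fun a ↦ expPair a (j - a)) (fun a ↦ expPair a (j + n - 1 - a))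
  have he : Function.Injective e := by
    refine Sum.map_injective.2 ⟨fun a b h ↦ Fin.ext (expPair_injective h).1,
      fun a b h ↦ Subtype.ext (expPair_injective h).1⟩
  have hB : imageBasis k n j = B ∘ e := by
    funext i
    rcases i with a | a
    · rw [Function.comp_apply, Module.Basis.prod_apply]
      exact congrArg (fun p ↦ (p, (0 : MvPolynomial (Fin 2) k)))
        (monomial_expPair (k := k) a (j - a)).symm
    · rw [Function.comp_apply, Module.Basis.prod_apply]
      exact congrArg (fun p ↦ ((0 : MvPolynomial (Fin 2) k), p))
        (monomial_expPair (k := k) a (j + n - 1 - a)).symm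
  rw [hB]
  exact B.linearIndependent.comp e he

lemma dualMap_monomial (d : Fin 4 →₀ ℕ) :
    dualMap k n (monomial d 1) =
      TrivSqZeroExt.inr (X 0 ^ n) ^ d 0 * TrivSqZeroExt.inr (X 1 ^ n) ^ d 1 *
        TrivSqZeroExt.inl (X 0 ^ d 2 * X 1 ^ d 3) := by
  rw [monomial_eq, Finsupp.prod_fintype _ _ (by simp)]
  simp [Fin.prod_univ_four, dualMap_X_zero, dualMap_X_one, dualMap_X_two, dualMap_X_three,
    mul_assoc]

lemma homogeneousSubmodule_eq_span_monomial (j : ℕ) :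
    homogeneousSubmodule (Fin 4) k j =
      Submodule.span k ((fun d ↦ monomial d (1 : k)) '' {d | d.degree = j}) := by
  rw [homogeneousSubmodule_eq_finsupp_supported]
  exact AddMonoidAlgebra.supported_eq_span_single _ _

lemma map_dualMap_eq_span (j : ℕ) :
    (homogeneousSubmodule (Fin 4) k j).map (dualMap k n).toLinearMap =
      Submodule.span k (Set.range (imageBasis k n j)) := by
  apply le_antisymm
  · rw [homogeneousSubmodule_eq_span_monomial, Submodule.map_span, Submodule.span_le]
    rintro _ ⟨_, ⟨d, hd, rfl⟩, rfl⟩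
    have hd' : d 0 + d 1 + d 2 + d 3 = j := by
      rw [← hd.out, Finsupp.degree_eq_sum, Fin.sum_univ_four]
    rw [SetLike.mem_coe, AlgHom.toLinearMap_apply, dualMap_monomial]
    generalize d 0 = p, d 1 = q, d 2 = r, d 3 = s at hd'
    have hsq (x : MvPolynomial (Fin 2) k) (m : ℕ) :
        (TrivSqZeroExt.inr x : DualNumber (MvPolynomial (Fin 2) k)) ^ (m + 2) = 0 := by
      rw [pow_add, pow_two, TrivSqZeroExt.inr_mul_inr, mul_zero]
    match p, q with
    | 0, 0 =>
      refine Submodule.subset_span ⟨.inl ⟨r, by omega⟩, ?_⟩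
      obtain rfl : s = j - r := by omega
      rw [pow_zero, pow_zero, one_mul, one_mul]
      rfl
    | 1, 0 =>
      refine Submodule.subset_span ⟨.inr ⟨n + r, ?_⟩, ?_⟩
      · simp only [epsExponents, Finset.mem_filter, Finset.mem_range]
        omega
      · obtain rfl : s = j + n - 1 - (n + r) := by omega
        rw [pow_zero, pow_one, mul_one, TrivSqZeroExt.inr_mul_inl, op_smul_eq_smul,
          smul_eq_mul, imageBasis, Sum.elim_inr]
        congr 1
        ring
    | 0, 1 =>
      refine Submodule.subset_span ⟨.inr ⟨r, ?_⟩, ?_⟩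
      · simp only [epsExponents, Finset.mem_filter, Finset.mem_range]
        omega
      · have hs : j + n - 1 - r = n + s := by omega
        rw [pow_zero, pow_one, one_mul, TrivSqZeroExt.inr_mul_inl, op_smul_eq_smul,
          smul_eq_mul, imageBasis, Sum.elim_inr]
        simp only [hs]
        congr 1
        ring
    | 1, 1 => simp only [pow_one, TrivSqZeroExt.inr_mul_inr, zero_mul, zero_mem]
    | m + 2, q => simp only [hsq, zero_mul, zero_mem]
    | p, m + 2 => simp only [hsq, mul_zero, zero_mul, zero_mem]
  · rw [Submodule.span_le]
    rintro _ ⟨a | ⟨a, ha⟩, rfl⟩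
    · refine ⟨X 2 ^ (a : ℕ) * X 3 ^ (j - a), ?_, ?_⟩
      · have h := (isHomogeneous_X_pow (R := k) (2 : Fin 4) (a : ℕ)).mul
          (isHomogeneous_X_pow (3 : Fin 4) (j - a))
        rwa [show (a : ℕ) + (j - a) = j by omega] at h
      · simp [imageBasis, dualMap_X_two, dualMap_X_three]
    · simp only [epsExponents, Finset.mem_filter, Finset.mem_range] at ha
      by_cases han : n ≤ a
      · refine ⟨X 0 * (X 2 ^ (a - n) * X 3 ^ (j + n - 1 - a)), ?_, ?_⟩
        · have h := (isHomogeneous_X k (0 : Fin 4)).mul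
            ((isHomogeneous_X_pow (R := k) (2 : Fin 4) (a - n)).mul
              (isHomogeneous_X_pow (3 : Fin 4) (j + n - 1 - a)))
          rwa [show 1 + (a - n + (j + n - 1 - a)) = j by omega] at h
        · rw [AlgHom.toLinearMap_apply, map_mul, map_mul, map_pow, map_pow, dualMap_X_zero,
            dualMap_X_two, dualMap_X_three, TrivSqZeroExt.inl_pow, TrivSqZeroExt.inl_pow,
            TrivSqZeroExt.inl_mul_inl, TrivSqZeroExt.inr_mul_inl, op_smul_eq_smul,
            smul_eq_mul, imageBasis, Sum.elim_inr, mul_right_comm, ← pow_add,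
            Nat.sub_add_cancel han]
      · refine ⟨X 1 * (X 2 ^ a * X 3 ^ (j - 1 - a)), ?_, ?_⟩
        · have h := (isHomogeneous_X k (1 : Fin 4)).mul
            ((isHomogeneous_X_pow (R := k) (2 : Fin 4) a).mul
              (isHomogeneous_X_pow (3 : Fin 4) (j - 1 - a)))
          rwa [show 1 + (a + (j - 1 - a)) = j by omega] at h
        · rw [AlgHom.toLinearMap_apply, map_mul, map_mul, map_pow, map_pow, dualMap_X_one,
            dualMap_X_two, dualMap_X_three, TrivSqZeroExt.inl_pow, TrivSqZeroExt.inl_pow,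
            TrivSqZeroExt.inl_mul_inl, TrivSqZeroExt.inr_mul_inl, op_smul_eq_smul,
            smul_eq_mul, imageBasis, Sum.elim_inr, mul_assoc, ← pow_add,
            show j - 1 - a + n = j + n - 1 - a by omega]

lemma hilbFn_eq (j : ℕ) : hilbFn k n j = j + 1 + (2 * j - (j - n)) := by
  rw [hilbFn_eq_finrank_map_dualMap, map_dualMap_eq_span,
    finrank_span_eq_card (linearIndependent_imageBasis j)]
  simp [card_epsExponents]

lemma mk_hilbFn_mul_one_sub_X_sq :
    (PowerSeries.mk fun j => (hilbFn k n j : ℤ)) * (1 - PowerSeries.X) ^ 2 =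
      1 + 2 * PowerSeries.X - PowerSeries.X ^ (n + 1) := by
  have hexp (F : PowerSeries ℤ) : F * (1 - PowerSeries.X) ^ 2 =
      F - F * PowerSeries.X - F * PowerSeries.X + F * PowerSeries.X * PowerSeries.X := by
    ring
  rw [hexp, two_mul]
  ext j
  rcases j with _ | _ | j
  · simp [hilbFn_eq]
  · simp only [map_sub, map_add, PowerSeries.coeff_succ_mul_X, PowerSeries.coeff_mk, hilbFn_eq,
      PowerSeries.coeff_zero_mul_X, PowerSeries.coeff_X_pow, PowerSeries.coeff_one,
      PowerSeries.coeff_X]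
    split_ifs <;> first | contradiction | omega
  · simp only [map_sub, map_add, PowerSeries.coeff_succ_mul_X, PowerSeries.coeff_mk, hilbFn_eq,
      PowerSeries.coeff_X_pow, PowerSeries.coeff_one, PowerSeries.coeff_X]
    split_ifs <;> first | contradiction | omega

lemma ringKrullDim_quotient_Jn : ringKrullDim (MvPolynomial (Fin 4) k ⧸ Jn k n) = 2 := by
  let f : MvPolynomial (Fin 4) k →ₐ[k] MvPolynomial (Fin 2) k :=
    (TrivSqZeroExt.fstHom k _ _).comp (dualMap k n)
  have hf : Function.Surjective f := fun a ↦ ⟨baseMap k a, by simp [f, dualMap_baseMap]⟩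
  have hle : Jn k n ≤ RingHom.ker f := fun p hp ↦ by
    have : dualMap k n p = 0 := Jn_le_ker_dualMap hp
    simp [f, this]
  have hrad : RingHom.ker f ≤ (Jn k n).radical := fun p hp ↦ by
    have h0 : (dualMap k n p).fst = 0 := hp
    refine ⟨2, ?_⟩
    rw [← ker_dualMap, RingHom.mem_ker, map_pow]
    ext <;> simp [pow_two, h0]
  have hz : PrimeSpectrum.zeroLocus (Jn k n : Set (MvPolynomial (Fin 4) k)) =
      PrimeSpectrum.zeroLocus (RingHom.ker f : Set (MvPolynomial (Fin 4) k)) := by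
    refine Set.Subset.antisymm ?_ (PrimeSpectrum.zeroLocus_anti_mono hle)
    rw [← PrimeSpectrum.zeroLocus_radical]
    exact PrimeSpectrum.zeroLocus_anti_mono hrad
  rw [ringKrullDim_quotient, hz, ← ringKrullDim_quotient,
    ringKrullDim_eq_of_ringEquiv (Ideal.quotientKerAlgEquivOfSurjective hf).toRingEquiv,
    MvPolynomial.ringKrullDim_of_isNoetherianRing, ringKrullDim_eq_zero_of_field]
  simp

end

/-- For `G = k[X,Y,Z,W]/(X², XY, Y², YZⁿ − XWⁿ)` (`n ≥ 1`), the
Hilbert series of `G` equals `(1 + 2t − t^{n+1})/(1 − t)²`; consequently `G` has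
dimension `2`, multiplicity `e₀(G) = h(1) = 2`, and first Hilbert coefficient
`e₁(G) = h'(1) = 1 − n`. -/
theorem stmt18 (k : Type*) [Field k] (n : ℕ) (hn : 1 ≤ n) :
    (PowerSeries.mk fun j => (hilbFn k n j : ℤ)) * (1 - PowerSeries.X) ^ 2 =
      1 + 2 * PowerSeries.X - PowerSeries.X ^ (n + 1) ∧
    ringKrullDim (MvPolynomial (Fin 4) k ⧸ Jn k n) = 2 ∧
    (hpoly n).eval 1 = 2 ∧
    (Polynomial.derivative (hpoly n)).eval 1 = 1 - (n : ℤ) := by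
  refine ⟨mk_hilbFn_mul_one_sub_X_sq, ringKrullDim_quotient_Jn, ?_, ?_⟩
  · norm_num [hpoly]
  · simp [hpoly]
    ring

end
end

section
/- Let k be a field, n ≥ 1, Q = k[[x, y, z, w]] and p_n = (x² − z^{2n+1}w, xy − z^{n+1}w^{n+1}, y² − zw^{2n+1}, yzⁿ − xwⁿ). Then p_n is contained in the kernel of the k-algebra homomorphism φ_n : Q → k[[s, t]] sending x ↦ st^{2n+1}, y ↦ s^{2n+1}t, z ↦ t², w ↦ s², and p_n has height 2. -/
noncomputable section

open MvPowerSeries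

/-- The ideal `p_n = (x² − z^{2n+1}w, xy − z^{n+1}w^{n+1}, y² − zw^{2n+1}, yzⁿ − xwⁿ)`
in `Q = k[[x, y, z, w]]`, where `x = X 0, y = X 1, z = X 2, w = X 3`. -/
def pn (k : Type*) [Field k] (n : ℕ) : Ideal (MvPowerSeries (Fin 4) k) :=
  Ideal.span {X 0 ^ 2 - X 2 ^ (2 * n + 1) * X 3,
    X 0 * X 1 - X 2 ^ (n + 1) * X 3 ^ (n + 1),
    X 1 ^ 2 - X 2 * X 3 ^ (2 * n + 1),
    X 1 * X 2 ^ n - X 0 * X 3 ^ n}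

theorem mem_map_C_of_forall_coeff_mem {A : Type*} [CommRing A] {p : Ideal A} (hp : p.FG)
    {f : PowerSeries A} (hf : ∀ i, PowerSeries.coeff i f ∈ p) :
    f ∈ p.map (PowerSeries.C (R := A)) := by
  obtain ⟨r, g, rfl⟩ := Submodule.fg_iff_exists_fin_generating_family.mp hp
  choose c hc using fun i => Ideal.mem_span_range_iff_exists_fun.mp (hf i)
  have hfc : f = ∑ j, PowerSeries.mk (fun i => c i j) * PowerSeries.C (g j) := by
    ext i
    simp [← hc i]
  rw [hfc]
  exact Ideal.sum_mem _ fun j _ => Ideal.mul_mem_left _ _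
    (Ideal.mem_map_of_mem _ (Submodule.subset_span ⟨j, rfl⟩))

/-- A prime of `A⟦X⟧` that contains a nonzero constant and a series with some coefficient `1`
has height at least two: the extension of its contraction to `A` lies strictly between. -/
theorem two_le_height_of_C_mem {A : Type*} [CommRing A] [IsDomain A] [IsNoetherianRing A]
    (P : Ideal (PowerSeries A)) [P.IsPrime] {a : A} (ha : a ≠ 0) (haP : PowerSeries.C a ∈ P)
    {f : PowerSeries A} (hf : f ∈ P) {m : ℕ} (hm : PowerSeries.coeff m f = 1) :
    2 ≤ P.height := by
  let p : Ideal A := P.comap PowerSeries.C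
  let q : Ideal (PowerSeries A) := RingHom.ker (PowerSeries.map (Ideal.Quotient.mk p))
  have hq (g : PowerSeries A) : g ∈ q ↔ ∀ i, PowerSeries.coeff i g ∈ p := by
    simp [q, RingHom.mem_ker, PowerSeries.ext_iff, Ideal.Quotient.eq_zero_iff_mem]
  have hp : p.IsPrime := inferInstanceAs (P.comap PowerSeries.C).IsPrime
  have hqprime : q.IsPrime := RingHom.ker_isPrime _
  have hqP : q ≤ P := fun g hg => Ideal.map_comap_le
    (mem_map_C_of_forall_coeff_mem (IsNoetherian.noetherian p) ((hq g).mp hg))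
  have hlt : q < P := lt_of_le_not_ge hqP fun h =>
    hp.ne_top ((Ideal.eq_top_iff_one _).mpr (hm ▸ (hq f).mp (h hf) m))
  have haq : PowerSeries.C a ∈ q := (hq _).mpr fun i => by
    rw [PowerSeries.coeff_C]
    split_ifs
    · exact haP
    · exact p.zero_mem
  have hbot : (⊥ : Ideal (PowerSeries A)) < q := bot_lt_iff_ne_bot.mpr fun h =>
    ha (PowerSeries.C_injective (by simpa using (h ▸ haq : PowerSeries.C a ∈ (⊥ : Ideal _))))
  calc (2 : ℕ∞) = 0 + 1 + 1 := by norm_num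
    _ ≤ (⊥ : Ideal (PowerSeries A)).height + 1 + 1 := by gcongr; exact zero_le
    _ ≤ q.height + 1 := by gcongr; exact Ideal.height_add_one_le_of_lt_of_isPrime hbot
    _ ≤ P.height := Ideal.height_add_one_le_of_lt_of_isPrime hlt

theorem two_le_height_of_pn_le {k : Type*} [Field k] {n : ℕ}
    (P : Ideal (MvPowerSeries (Fin 4) k)) [P.IsPrime] (h : pn k n ≤ P) : 2 ≤ P.height := by
  have : IsDomain (MvPowerSeries (Fin 3) k) := NoZeroDivisors.to_isDomain _
  let e := (finSuccEquiv k 3).toRingEquiv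
  have e0 : e (X 0) = PowerSeries.X := finSuccEquiv_X_zero
  have e1 : e (X 1) = PowerSeries.C (X 0) := finSuccEquiv_X_succ 0
  have e2 : e (X 2) = PowerSeries.C (X 1) := finSuccEquiv_X_succ 1
  have e3 : e (X 3) = PowerSeries.C (X 2) := finSuccEquiv_X_succ 2
  rw [← RingEquiv.height_comap e.symm P]
  have hmem (g : MvPowerSeries (Fin 4) k) (hg : g ∈ pn k n) : e g ∈ P.comap e.symm := by
    simpa [Ideal.mem_comap] using h hg
  have h1 := hmem (X 0 ^ 2 - X 2 ^ (2 * n + 1) * X 3) (Ideal.subset_span (by simp))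
  have h3 := hmem (X 1 ^ 2 - X 2 * X 3 ^ (2 * n + 1)) (Ideal.subset_span (by simp))
  simp only [map_sub, map_mul, map_pow, e0, e1, e2, e3] at h1 h3
  simp only [← map_pow, ← map_mul, ← map_sub] at h1 h3
  refine two_le_height_of_C_mem _ ?_ h3 h1 (m := 2) ?_
  · intro h0
    have f0 : finSuccEquiv k 2 (X 0) = PowerSeries.X := finSuccEquiv_X_zero
    have f1 : finSuccEquiv k 2 (X 1) = PowerSeries.C (X 0) := finSuccEquiv_X_succ 0
    have f2 : finSuccEquiv k 2 (X 2) = PowerSeries.C (X 1) := finSuccEquiv_X_succ 1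
    have h0' := congrArg (finSuccEquiv k 2) h0
    simp only [map_sub, map_mul, map_pow, f0, f1, f2, map_zero] at h0'
    simp only [← map_pow, ← map_mul] at h0'
    simpa [PowerSeries.coeff_X_pow, PowerSeries.coeff_C, -map_mul, -map_pow] using
      congrArg (PowerSeries.coeff 2) h0'
  · simp [PowerSeries.coeff_X_pow, -map_mul, -map_pow]

/-- Away from `z = 0` the ideal `p_n` is generated by its first and last generators. -/
theorem pn_le_of_isPrime {k : Type*} [Field k] {n : ℕ}
    {P : Ideal (MvPowerSeries (Fin 4) k)} [hP : P.IsPrime] (hz : X 2 ∉ P)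
    (h1 : X 0 ^ 2 - X 2 ^ (2 * n + 1) * X 3 ∈ P) (h4 : X 1 * X 2 ^ n - X 0 * X 3 ^ n ∈ P) :
    pn k n ≤ P := by
  have hz' {m : ℕ} {g : MvPowerSeries (Fin 4) k} (h : X 2 ^ m * g ∈ P) : g ∈ P :=
    (hP.mem_or_mem h).resolve_left fun h => hz (hP.mem_of_pow_mem _ h)
  rw [pn, Ideal.span_le]
  rintro _ (rfl | rfl | rfl | rfl)
  · exact h1
  · refine hz' (m := n) ?_
    convert! P.add_mem (P.mul_mem_left (X 0) h4) (P.mul_mem_left (X 3 ^ n) h1) using 1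
    ring
  · refine hz' (m := 2 * n) ?_
    convert! P.add_mem (P.mul_mem_left (X 1 * X 2 ^ n + X 0 * X 3 ^ n) h4)
      (P.mul_mem_left (X 3 ^ (2 * n)) h1) using 1
    ring
  · exact h4

theorem exists_isPrime_pn_le_height_le_two {k : Type*} [Field k] {n : ℕ}
    {J : Ideal (MvPowerSeries (Fin 4) k)} [J.IsPrime] (hJ : pn k n ≤ J) (hz : X 2 ∉ J) :
    ∃ P : Ideal (MvPowerSeries (Fin 4) k), P.IsPrime ∧ pn k n ≤ P ∧ P.height ≤ 2 := by
  let S : Set (MvPowerSeries (Fin 4) k) :=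
    {X 0 ^ 2 - X 2 ^ (2 * n + 1) * X 3, X 1 * X 2 ^ n - X 0 * X 3 ^ n}
  have hS : Ideal.span S ≤ J := (Ideal.span_mono (by
    rintro _ (rfl | rfl) <;> simp)).trans hJ
  obtain ⟨P, hP, hPJ⟩ := Ideal.exists_minimalPrimes_le hS
  have hprime : P.IsPrime := hP.isPrime
  have hSP : Ideal.span S ≤ P := hP.1.2
  refine ⟨P, hprime, pn_le_of_isPrime (fun h => hz (hPJ h))
    (hSP (Ideal.subset_span (by simp [S]))) (hSP (Ideal.subset_span (by simp [S]))), ?_⟩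
  refine (Ideal.height_le_card_of_mem_minimalPrimes_span (Set.toFinite S) hP).trans ?_
  exact_mod_cast (Set.ncard_insert_le _ _).trans (by simp)

/-- For any field `k` and `n ≥ 1`: `p_n` is contained in the kernel
of the (continuous) `k`-algebra homomorphism `φ_n : k[[x,y,z,w]] → k[[s,t]]` with
`x ↦ st^{2n+1}`, `y ↦ s^{2n+1}t`, `z ↦ t²`, `w ↦ s²` (here `s = X 0`, `t = X 1`), and
`p_n` has height `2`. -/
theorem stmt19 (k : Type*) [Field k] (n : ℕ) (hn : 1 ≤ n) :
    (∃ φ : MvPowerSeries (Fin 4) k →ₐ[k] MvPowerSeries (Fin 2) k,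
      φ (X 0) = X 0 * X 1 ^ (2 * n + 1) ∧
      φ (X 1) = X 0 ^ (2 * n + 1) * X 1 ∧
      φ (X 2) = X 1 ^ 2 ∧
      φ (X 3) = X 0 ^ 2 ∧
      pn k n ≤ RingHom.ker φ.toRingHom) ∧
    idealHeight (pn k n) = 2 := by
  have ha : HasSubst (S := k) (![X 0 * X 1 ^ (2 * n + 1), X 0 ^ (2 * n + 1) * X 1, X 1 ^ 2,
      X 0 ^ 2] : Fin 4 → MvPowerSeries (Fin 2) k) :=
    hasSubst_of_constantCoeff_zero fun s => by fin_cases s <;> simp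
  let φ : MvPowerSeries (Fin 4) k →ₐ[k] MvPowerSeries (Fin 2) k := substAlgHom ha
  have h0 : φ (X 0) = X 0 * X 1 ^ (2 * n + 1) := substAlgHom_X ha 0
  have h1 : φ (X 1) = X 0 ^ (2 * n + 1) * X 1 := substAlgHom_X ha 1
  have h2 : φ (X 2) = X 1 ^ 2 := substAlgHom_X ha 2
  have h3 : φ (X 3) = X 0 ^ 2 := substAlgHom_X ha 3
  have hker : pn k n ≤ RingHom.ker φ.toRingHom := by
    rw [pn, Ideal.span_le]
    rintro _ (rfl | rfl | rfl | rfl) <;>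
      simp only [SetLike.mem_coe, RingHom.mem_ker, AlgHom.toRingHom_eq_coe, RingHom.coe_coe,
        map_sub, map_mul, map_pow, h0, h1, h2, h3] <;> ring
  refine ⟨⟨φ, h0, h1, h2, h3, hker⟩, le_antisymm ?_ ?_⟩
  · have : IsDomain (MvPowerSeries (Fin 2) k) := NoZeroDivisors.to_isDomain _
    have hprime : (RingHom.ker φ.toRingHom).IsPrime := RingHom.ker_isPrime _
    have hz : X 2 ∉ RingHom.ker φ.toRingHom := by
      intro h
      have h' : φ (X 2) = 0 := h
      rw [h2] at h'
      simpa [X_pow_eq] using congrArg (coeff (Finsupp.single 1 2)) h'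
    obtain ⟨P, hP, hle, hht⟩ := exists_isPrime_pn_le_height_le_two hker hz
    exact (iInf_le _ ⟨⟨P, hP⟩, hle⟩).trans
      ((PrimeSpectrum.height_eq_orderHeight ⟨P, hP⟩).symm ▸ hht)
  · refine le_iInf fun p => ?_
    have hp := p.1.isPrime
    rw [← PrimeSpectrum.height_eq_orderHeight]
    exact two_le_height_of_pn_le _ p.2

end
end
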